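/- There is no access structure Γ on 6 players satisfying monotonicity, no-cloning and no-redundancy that admits a pure QSS state. -/

import Mathlib

open Finset

/-- Monotonicity of an access structure on `n` players (players = `Fin n`). -/
def Monotonic {n : ℕ} (Γ : Finset (Fin n) → Prop) : Prop :=
  ∀ A B : Finset (Fin n), Γ A → A ⊆ B → Γ B

/-- No-cloning: a set is authorized iff its complement is not. -/
def NoCloning {n : ℕ} (Γ : Finset (Fin n) → Prop) : Prop :=
  ∀ A : Finset (Fin n), Γ A ↔ ¬ Γ Aᶜ

/-- `A` is a minimal authorized set of `Γ`. -/
def IsMinimal {n : ℕ} (Γ : Finset (Fin n) → Prop) (A : Finset (Fin n)) : Prop :=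
  Γ A ∧ ∀ B : Finset (Fin n), B ⊂ A → ¬ Γ B

/-- No-redundancy: every player lies in some minimal authorized set. -/
def NoRedundancy {n : ℕ} (Γ : Finset (Fin n) → Prop) : Prop :=
  ∀ i : Fin n, ∃ A : Finset (Fin n), IsMinimal Γ A ∧ i ∈ A

noncomputable section

/-- Combine an assignment on `A` and one on `Aᶜ` into a full bit string. -/
def glue {m : ℕ} (A : Finset (Fin m)) (u : {x // x ∈ A} → Fin 2)
    (w : {x // x ∈ Aᶜ} → Fin 2) : Fin m → Fin 2 :=
  fun x => if h : x ∈ A then u ⟨x, h⟩ else w ⟨x, Finset.mem_compl.mpr h⟩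

/-- Reduced density matrix of the pure state `ψ` on the qubit positions in `A`:
the partial trace over the positions outside `A` of `ψψ†`. -/
def reducedDensity {m : ℕ} (ψ : (Fin m → Fin 2) → ℂ) (A : Finset (Fin m)) :
    Matrix ({x // x ∈ A} → Fin 2) ({x // x ∈ A} → Fin 2) ℂ :=
  fun u v => ∑ w : {x // x ∈ Aᶜ} → Fin 2,
    ψ (glue A u w) * (starRingEnd ℂ) (ψ (glue A v w))

/-- The reduction of `ψ` to `A` is maximally mixed, i.e. equals `2^{-|A|} · I`. -/
def MaximallyMixed {m : ℕ} (ψ : (Fin m → Fin 2) → ℂ) (A : Finset (Fin m)) : Prop :=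
  reducedDensity ψ A =
    ((2 : ℂ) ^ A.card)⁻¹ •
      (1 : Matrix ({x // x ∈ A} → Fin 2) ({x // x ∈ A} → Fin 2) ℂ)

open Classical in
/-- Von Neumann entropy (natural logarithm): sum of `-λ log λ` over the eigenvalues. -/
def vnEntropy {ι : Type} [Fintype ι] [DecidableEq ι] (ρ : Matrix ι ι ℂ) : ℝ :=
  if h : ρ.IsHermitian then ∑ i, Real.negMulLog (h.eigenvalues i) else 0

/-- Entropy of the reduction of `ψ` to the set `A` of qubit positions. -/
def Sent {m : ℕ} (ψ : (Fin m → Fin 2) → ℂ) (A : Finset (Fin m)) : ℝ :=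
  vnEntropy (reducedDensity ψ A)

/-- The qubit positions (in `{0,1,…,n} = Fin (n+1)`, where `0` is the reference qubit)
of a set of players `A ⊆ Fin n`: player `i` holds position `i.succ`. -/
def posOf {n : ℕ} (A : Finset (Fin n)) : Finset (Fin (n + 1)) := A.image Fin.succ

/-- `ψ` is a pure QSS state for the access structure `Γ`: a normalized pure state of
`n+1` qubits (position `0` being the reference qubit `R`) satisfying Recoverability
`S(R) + S(A) - S(R ∪ A) = 2 log 2` for authorized `A` and Secrecy
`S(R) + S(B) - S(R ∪ B) = 0` for unauthorized `B`. -/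
structure IsPureQSSState {n : ℕ} (Γ : Finset (Fin n) → Prop)
    (ψ : (Fin (n + 1) → Fin 2) → ℂ) : Prop where
  normalized : ∑ x : Fin (n + 1) → Fin 2, ‖ψ x‖ ^ 2 = 1
  recover : ∀ A : Finset (Fin n), Γ A →
    Sent ψ {0} + Sent ψ (posOf A) - Sent ψ (insert 0 (posOf A)) = 2 * Real.log 2
  secrecy : ∀ B : Finset (Fin n), ¬ Γ B →
    Sent ψ {0} + Sent ψ (posOf B) - Sent ψ (insert 0 (posOf B)) = 0

end


open Matrix Polynomial ComplexOrder

lemma vn_eq {ι : Type} [Fintype ι] [DecidableEq ι] {ρ : Matrix ι ι ℂ} (h : ρ.IsHermitian) :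
    vnEntropy ρ = (ρ.charpoly.roots.map (fun z => Real.negMulLog z.re)).sum := by
  rw [vnEntropy, dif_pos h, h.roots_charpoly_eq_eigenvalues]
  simp [Multiset.map_map]

lemma vn_congr {ι κ : Type} [Fintype ι] [DecidableEq ι] [Fintype κ] [DecidableEq κ]
    {ρ : Matrix ι ι ℂ} {σ : Matrix κ κ ℂ} (h : ρ.IsHermitian) (h' : σ.IsHermitian)
    (hc : (X : ℂ[X]) ^ Fintype.card κ * ρ.charpoly = X ^ Fintype.card ι * σ.charpoly) :
    vnEntropy ρ = vnEntropy σ := by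
  rw [vn_eq h, vn_eq h']
  have h2 := congrArg Polynomial.roots hc
  rw [roots_mul (mul_ne_zero (pow_ne_zero _ X_ne_zero) (charpoly_monic ρ).ne_zero),
    roots_mul (mul_ne_zero (pow_ne_zero _ X_ne_zero) (charpoly_monic σ).ne_zero)] at h2
  have h3 := congrArg (fun s => (s.map (fun z : ℂ => Real.negMulLog z.re)).sum) h2
  simpa [Multiset.map_nsmul, Multiset.sum_nsmul] using h3

lemma vn_diagonal {ι : Type} [Fintype ι] [DecidableEq ι] (d : ι → ℝ) :
    vnEntropy (diagonal (fun i => (d i : ℂ))) = ∑ i, Real.negMulLog (d i) := by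
  rw [vn_eq (by rw [isHermitian_diagonal_iff]; intro i; simp [IsSelfAdjoint]), charpoly_diagonal]
  have : (∏ i : ι, (X - C (d i : ℂ))).roots = Finset.univ.val.map (fun i => (d i : ℂ)) := by
    have := roots_multiset_prod_X_sub_C (Finset.univ.val.map (fun i => (d i : ℂ)))
    rwa [Multiset.map_map] at this
  rw [this]
  simp [Multiset.map_map]

lemma vn_le_diag {ι : Type} [Fintype ι] [DecidableEq ι] {ρ : Matrix ι ι ℂ} (h : ρ.PosSemidef) :
    vnEntropy ρ ≤ ∑ i, Real.negMulLog (ρ i i).re ∧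
    (vnEntropy ρ = ∑ i, Real.negMulLog (ρ i i).re → ∀ i j, i ≠ j → ρ i j = 0) := by
  have hH := h.1
  set U : Matrix ι ι ℂ := (hH.eigenvectorUnitary : Matrix ι ι ℂ) with hU
  set p := hH.eigenvalues with hp
  have hsp : ∀ i j, ρ i j = ∑ k, U i k * p k * star (U j k) := by
    intro i j
    have := congrFun (congrFun hH.spectral_theorem i) j
    rw [Unitary.conjStarAlgAut_apply] at this
    rw [this]
    simp [Matrix.mul_apply, diagonal_apply, star_eq_conjTranspose, hU, hp]
  have hUU : U * star U = 1 := Unitary.mul_star_self_of_mem hH.eigenvectorUnitary.2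
  have hUU' : star U * U = 1 := Unitary.star_mul_self_of_mem hH.eigenvectorUnitary.2
  have row : ∀ i, ∑ k, Complex.normSq (U i k) = 1 := by
    intro i
    have := congrFun (congrFun hUU i) i
    rw [Matrix.mul_apply] at this
    simp [star_eq_conjTranspose, Complex.mul_conj] at this
    exact_mod_cast this
  have col : ∀ k, ∑ i, Complex.normSq (U i k) = 1 := by
    intro i
    have := congrFun (congrFun hUU' i) i
    rw [Matrix.mul_apply] at this
    simp [star_eq_conjTranspose, mul_comm, Complex.mul_conj] at this
    exact_mod_cast this
  have hd : ∀ i, (ρ i i).re = ∑ k, Complex.normSq (U i k) • p k := by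
    intro i
    rw [hsp i i, Complex.re_sum]
    refine Finset.sum_congr rfl fun k _ => ?_
    have : U i k * p k * star (U i k) = ((Complex.normSq (U i k) * p k : ℝ) : ℂ) := by
      rw [mul_right_comm, Complex.star_def, Complex.mul_conj]; push_cast; ring
    rw [this, Complex.ofReal_re, smul_eq_mul]
  have hp0 : ∀ k ∈ (Finset.univ : Finset ι), p k ∈ Set.Ici (0:ℝ) := fun k _ => h.eigenvalues_nonneg k
  have jen : ∀ i, ∑ k, Complex.normSq (U i k) • Real.negMulLog (p k) ≤ Real.negMulLog (ρ i i).re := by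
    intro i
    rw [hd i]
    exact Real.concaveOn_negMulLog.le_map_sum (fun k _ => Complex.normSq_nonneg _) (row i) hp0
  have hS : vnEntropy ρ = ∑ i, ∑ k, Complex.normSq (U i k) • Real.negMulLog (p k) := by
    rw [vnEntropy, dif_pos hH, Finset.sum_comm]
    refine Finset.sum_congr rfl fun k _ => ?_
    rw [← Finset.sum_smul, col k, one_smul]
  refine ⟨hS ▸ Finset.sum_le_sum fun i _ => jen i, fun heq i j hij => ?_⟩
  rw [hS] at heq
  have he := (Finset.sum_eq_sum_iff_of_le (fun i _ => jen i)).1 heq i (Finset.mem_univ _)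
  have hk := (Real.strictConcaveOn_negMulLog.map_sum_eq_iff_of_nonneg
    (fun k _ => Complex.normSq_nonneg (U i k)) (row i) hp0).1 (by rw [← hd i]; exact he.symm)
  have hz : ρ i j = (ρ i i).re * (U * star U) i j := by
    rw [hsp, Matrix.mul_apply, Finset.mul_sum]
    refine Finset.sum_congr rfl fun k _ => ?_
    by_cases hu : U i k = 0
    · simp [hu]
    · have hpk : (ρ i i).re = p k := by
        rw [hd i]
        have : ∀ j ∈ Finset.univ, Complex.normSq (U i j) • p j = Complex.normSq (U i j) • p k := by
          intro j _
          by_cases huj : U i j = 0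
          · simp [huj]
          · rw [hk (Finset.mem_univ j) (by simpa using huj) (Finset.mem_univ k) (by simpa using hu)]
        rw [Finset.sum_congr rfl this, ← Finset.sum_smul, row i, one_smul]
      rw [hpk, star_apply]; ring
  rw [hz, hUU, one_apply_ne hij, mul_zero]

/-- partial trace over the second (qubit) factor -/
def ptr {α : Type} (ρ : Matrix (α × Fin 2) (α × Fin 2) ℂ) : Matrix α α ℂ :=
  fun u v => ∑ b, ρ (u, b) (v, b)

lemma negMulLog_half (q : ℝ) : 2 * Real.negMulLog (q / 2) = Real.negMulLog q + q * Real.log 2 := by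
  rw [div_eq_mul_inv, Real.negMulLog_mul]
  simp [Real.negMulLog]
  ring

lemma two_le (a b : ℝ) (ha : 0 ≤ a) (hb : 0 ≤ b) :
    Real.negMulLog a + Real.negMulLog b ≤ Real.negMulLog (a + b) + (a + b) * Real.log 2 ∧
    (Real.negMulLog a + Real.negMulLog b = Real.negMulLog (a + b) + (a + b) * Real.log 2 → a = b) := by
  rw [← negMulLog_half]
  by_cases hab : a = b
  · subst hab
    refine ⟨?_, fun _ => rfl⟩
    rw [add_self_div_two]; linarith
  · have := Real.strictConcaveOn_negMulLog.2 (show a ∈ Set.Ici (0:ℝ) from ha)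
      (show b ∈ Set.Ici (0:ℝ) from hb) hab (show (0:ℝ) < 1/2 by norm_num)
      (show (0:ℝ) < 1/2 by norm_num) (by norm_num)
    simp only [smul_eq_mul] at this
    rw [show 1 / 2 * a + 1 / 2 * b = (a + b) / 2 by ring] at this
    exact ⟨by linarith, fun h => by linarith⟩

/-- block unitary `V ⊗ 1` -/
def tens {α : Type} (V : Matrix α α ℂ) : Matrix (α × Fin 2) (α × Fin 2) ℂ :=
  fun x y => if x.2 = y.2 then V x.1 y.1 else 0

lemma tens_mul {α : Type} [Fintype α] (V W : Matrix α α ℂ) : tens V * tens W = tens (V * W) := by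
  ext ⟨x, a⟩ ⟨y, b⟩
  simp [tens, Matrix.mul_apply, Fintype.sum_prod_type, ite_and]

lemma tens_one {α : Type} [DecidableEq α] : tens (1 : Matrix α α ℂ) = 1 := by
  ext ⟨x, a⟩ ⟨y, b⟩
  simp [tens, Matrix.one_apply, ← ite_and, and_comm]

lemma tens_star {α : Type} (V : Matrix α α ℂ) : (tens V)ᴴ = tens Vᴴ := by
  ext ⟨x, a⟩ ⟨y, b⟩
  by_cases h : a = b <;> simp [tens, h, Ne.symm]

lemma ptr_conj {α : Type} [Fintype α] (V W : Matrix α α ℂ)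
    (ρ : Matrix (α × Fin 2) (α × Fin 2) ℂ) :
    ptr (tens V * ρ * tens W) = V * ptr ρ * W := by
  ext u v
  simp only [ptr, tens, Matrix.mul_apply, Fintype.sum_prod_type, Fin.sum_univ_two]
  simp [Finset.sum_mul, Finset.mul_sum, Finset.sum_add_distrib, mul_add, add_mul]

lemma vn_conj {ι : Type} [Fintype ι] [DecidableEq ι] {ρ V : Matrix ι ι ℂ} (h : ρ.IsHermitian)
    (hV : V * Vᴴ = 1) : vnEntropy (Vᴴ * ρ * V) = vnEntropy ρ := by
  refine vn_congr (isHermitian_conjTranspose_mul_mul V h) h ?_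
  rw [charpoly_mul_comm, ← Matrix.mul_assoc, hV, Matrix.one_mul]

lemma vn_ptr {α : Type} [Fintype α] [DecidableEq α] {ρ : Matrix (α × Fin 2) (α × Fin 2) ℂ}
    (h : ρ.PosSemidef) (htr : (ptr ρ).trace = 1) (hh : (ptr ρ).IsHermitian) :
    vnEntropy ρ ≤ vnEntropy (ptr ρ) + Real.log 2 ∧
    (vnEntropy ρ = vnEntropy (ptr ρ) + Real.log 2 ↔ ρ = (1/2 : ℂ) • tens (ptr ρ)) := by
  set V : Matrix α α ℂ := (hh.eigenvectorUnitary : Matrix α α ℂ) with hVdef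
  have hV : V * Vᴴ = 1 := Unitary.mul_star_self_of_mem hh.eigenvectorUnitary.2
  have hV' : Vᴴ * V = 1 := Unitary.star_mul_self_of_mem hh.eigenvectorUnitary.2
  have hsp : ptr ρ = V * diagonal (fun i => (hh.eigenvalues i : ℂ)) * Vᴴ := by
    conv_lhs => rw [hh.spectral_theorem, Unitary.conjStarAlgAut_apply]
    rfl
  set q := hh.eigenvalues with hq
  have hdiag : Vᴴ * ptr ρ * V = diagonal (fun i => (q i : ℂ)) := by
    rw [hsp]
    calc Vᴴ * (V * diagonal (fun i => (q i : ℂ)) * Vᴴ) * V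
      _ = (Vᴴ * V) * diagonal (fun i => (q i : ℂ)) * (Vᴴ * V) := by noncomm_ring
      _ = _ := by rw [hV']; simp
  have hW : tens V * (tens V)ᴴ = 1 := by rw [tens_star, tens_mul, hV, tens_one]
  have hW' : (tens V)ᴴ * tens V = 1 := by rw [tens_star, tens_mul, hV', tens_one]
  have hS1 : vnEntropy (ptr ρ) = ∑ l, Real.negMulLog (q l) := by rw [vnEntropy, dif_pos hh]
  have hq1 : ∑ l, q l = 1 := by
    have := hh.trace_eq_sum_eigenvalues
    rw [htr] at this
    have h2 := congrArg Complex.re this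
    simpa using h2.symm
  set σ := (tens V)ᴴ * ρ * tens V with hσ
  have hσp : σ.PosSemidef := h.conjTranspose_mul_mul_same _
  have hSσ : vnEntropy σ = vnEntropy ρ := vn_conj h.1 hW
  have hpσ : ptr σ = diagonal (fun i => (q i : ℂ)) := by
    rw [hσ, tens_star, ptr_conj, hdiag]
  have hρσ : ρ = tens V * σ * (tens V)ᴴ := by
    rw [hσ]
    calc ρ = 1 * ρ * 1 := by simp
      _ = (tens V * (tens V)ᴴ) * ρ * (tens V * (tens V)ᴴ) := by rw [hW]
      _ = _ := by noncomm_ring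
  have hd0 : ∀ x, 0 ≤ (σ x x).re := fun x => (Complex.nonneg_iff.1 (hσp.diag_nonneg)).1
  have hds : ∀ l, (σ (l,0) (l,0)).re + (σ (l,1) (l,1)).re = q l := by
    intro l
    have := congrFun (congrFun hpσ l) l
    simp [ptr] at this
    have := congrArg Complex.re this
    simpa using this
  have hT : ∑ l, (Real.negMulLog (q l) + q l * Real.log 2) = vnEntropy (ptr ρ) + Real.log 2 := by
    rw [Finset.sum_add_distrib, ← Finset.sum_mul, hq1, hS1, one_mul]
  have hterm : ∀ l ∈ Finset.univ, Real.negMulLog (σ (l,0) (l,0)).re + Real.negMulLog (σ (l,1) (l,1)).re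
      ≤ Real.negMulLog (q l) + q l * Real.log 2 := by
    intro l _
    have := (two_le _ _ (hd0 (l,0)) (hd0 (l,1))).1
    rwa [hds l] at this
  have hP := vn_le_diag hσp
  rw [Fintype.sum_prod_type] at hP
  simp only [Fin.sum_univ_two] at hP
  have hle := Finset.sum_le_sum hterm
  rw [hT] at hle
  refine ⟨?_, ?_, ?_⟩
  · rw [← hSσ]; exact hP.1.trans hle
  · intro heq
    rw [← hSσ] at heq
    have e1 := hP.2 (le_antisymm hP.1 (heq ▸ hle))
    have e2 := (Finset.sum_eq_sum_iff_of_le hterm).1 (by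
      rw [hT]; exact le_antisymm hle (heq ▸ hP.1))
    have hσ2 : σ = (1/2 : ℂ) • tens (diagonal (fun i => (q i : ℂ))) := by
      ext ⟨x, a⟩ ⟨y, b⟩
      by_cases hxy : (x, a) = (y, b)
      · obtain ⟨rfl, rfl⟩ := Prod.mk.inj hxy
        have e3 := e2 x (Finset.mem_univ _)
        rw [← hds x] at e3
        have e4 := (two_le _ _ (hd0 (x,0)) (hd0 (x,1))).2 e3
        have e5 := hds x
        have him : (σ (x,a) (x,a)).im = 0 := (Complex.nonneg_iff.1 (hσp.diag_nonneg)).2.symm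
        have hre : (σ (x,a) (x,a)).re = q x / 2 := by
          fin_cases a
          · show (σ (x,0) (x,0)).re = q x / 2
            linarith
          · show (σ (x,1) (x,1)).re = q x / 2
            linarith
        apply Complex.ext
        · simp [tens, hre]; ring
        · simp [tens, him]
      · rw [e1 _ _ hxy]
        simp only [Matrix.smul_apply, tens, diagonal_apply]
        by_cases hab : a = b
        · have : x ≠ y := fun h => hxy (by rw [h, hab])
          simp [this]
        · simp [hab]
    rw [hsp]
    refine hρσ.trans ?_
    rw [hσ2, tens_star, Matrix.mul_smul, Matrix.smul_mul, tens_mul, tens_mul]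
  · intro hρ
    have : σ = diagonal (fun x : α × Fin 2 => ((q x.1 / 2 : ℝ) : ℂ)) := by
      rw [hσ, hρ, tens_star, Matrix.mul_smul, Matrix.smul_mul, tens_mul, tens_mul, hdiag]
      ext ⟨x, a⟩ ⟨y, b⟩
      by_cases hab : a = b <;> by_cases hxy : x = y <;> simp [tens, hab, hxy, diagonal_apply]
      ring
    rw [← hSσ, this, vn_diagonal, Fintype.sum_prod_type]
    simp only [Fin.sum_univ_two, ← hT]
    refine Finset.sum_congr rfl fun l _ => ?_
    rw [← negMulLog_half]; ring

section plumbing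
variable {m : ℕ} (ψ : (Fin m → Fin 2) → ℂ)

/-- matrix of amplitudes -/
def amp (A : Finset (Fin m)) : Matrix ({x // x ∈ A} → Fin 2) ({x // x ∈ Aᶜ} → Fin 2) ℂ :=
  fun u w => ψ (glue A u w)

lemma rd_eq (A : Finset (Fin m)) : reducedDensity ψ A = amp ψ A * (amp ψ A)ᴴ := by
  ext u v
  simp [reducedDensity, amp, Matrix.mul_apply]

lemma rd_psd (A : Finset (Fin m)) : (reducedDensity ψ A).PosSemidef := by
  rw [rd_eq]; exact posSemidef_self_mul_conjTranspose _

/-- gluing as an equivalence -/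
def glueEquiv (A : Finset (Fin m)) :
    (({x // x ∈ A} → Fin 2) × ({x // x ∈ Aᶜ} → Fin 2)) ≃ (Fin m → Fin 2) where
  toFun p := glue A p.1 p.2
  invFun x := (fun i => x i, fun i => x i)
  left_inv p := by
    obtain ⟨u, w⟩ := p
    ext i
    · simp [glue]
    · have := Finset.mem_compl.1 i.2
      simp [glue, this]
  right_inv x := by
    ext i
    simp [glue]

/-- index equivalence for the double complement -/
def ccEquiv (A : Finset (Fin m)) : ({x // x ∈ Aᶜᶜ} → Fin 2) ≃ ({x // x ∈ A} → Fin 2) :=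
  Equiv.arrowCongr (Equiv.subtypeEquivRight (by simp)) (Equiv.refl _)

lemma rd_compl (A : Finset (Fin m)) :
    reducedDensity ψ Aᶜ = ((amp ψ A)ᴴ * amp ψ A)ᵀ := by
  ext u v
  simp only [reducedDensity, amp, Matrix.mul_apply, Matrix.transpose_apply, conjTranspose_apply]
  refine Fintype.sum_equiv (ccEquiv A) _ _ fun w => ?_
  have key : ∀ u : {x // x ∈ Aᶜ} → Fin 2, glue Aᶜ u w = glue A (ccEquiv A w) u := by
    intro u
    ext i
    by_cases hi : i ∈ A
    · simp [glue, hi, ccEquiv]; rfl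
    · simp [glue, hi]
  rw [key, key, mul_comm]; rfl

lemma Sent_compl (A : Finset (Fin m)) : Sent ψ Aᶜ = Sent ψ A := by
  refine vn_congr (rd_psd ψ _).1 (rd_psd ψ _).1 ?_
  rw [rd_compl, charpoly_transpose, rd_eq]
  exact (charpoly_mul_comm' _ _).symm

lemma rd_trace (hn : ∑ x, ‖ψ x‖ ^ 2 = 1) (A : Finset (Fin m)) :
    (reducedDensity ψ A).trace = 1 := by
  have : (reducedDensity ψ A).trace = ((∑ x, ‖ψ x‖ ^ 2 : ℝ) : ℂ) := by
    rw [← (glueEquiv A).sum_comp, Fintype.sum_prod_type]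
    push_cast
    simp only [Matrix.trace, Matrix.diag, reducedDensity]
    refine Finset.sum_congr rfl fun u _ => Finset.sum_congr rfl fun w _ => ?_
    rw [Complex.mul_conj']; rfl
  rw [this, hn]; simp

lemma Sent_empty (hn : ∑ x, ‖ψ x‖ ^ 2 = 1) : Sent ψ ∅ = 0 := by
  have h := (rd_psd ψ ∅).1
  rw [Sent, vnEntropy, dif_pos h]
  have ht := h.trace_eq_sum_eigenvalues
  rw [rd_trace ψ hn] at ht
  have h2 := congrArg Complex.re ht
  rw [Complex.re_sum, Fintype.sum_unique] at h2
  rw [Fintype.sum_unique]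
  have h3 := (Complex.one_re.symm.trans h2).trans (Complex.ofReal_re _)
  exact (congrArg Real.negMulLog h3.symm).trans Real.negMulLog_one

/-- scaled reduced density on full strings -/
def rr (X : Finset (Fin m)) (x y : Fin m → Fin 2) : ℂ :=
  ∑ w : Fin m → Fin 2, ψ (X.piecewise x w) * (starRingEnd ℂ) (ψ (X.piecewise y w))

lemma rr_eq (X : Finset (Fin m)) (x y : Fin m → Fin 2) :
    rr ψ X x y = 2 ^ X.card * reducedDensity ψ X (fun i => x i) (fun i => y i) := by
  have hp : ∀ (x : Fin m → Fin 2) (p : (({x // x ∈ X} → Fin 2) × ({x // x ∈ Xᶜ} → Fin 2))),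
      X.piecewise x (glueEquiv X p) = glue X (fun i => x i) p.2 := by
    intro x p
    ext i
    by_cases hi : i ∈ X <;> simp [glue, glueEquiv, hi]
  rw [rr, ← (glueEquiv X).sum_comp, Fintype.sum_prod_type]
  simp only [hp, reducedDensity]
  simp

lemma rr_sum {X : Finset (Fin m)} {i : Fin m} (hi : i ∉ X) (x y : Fin m → Fin 2) :
    ∑ b, rr ψ (insert i X) (Function.update x i b) (Function.update y i b) = 2 * rr ψ X x y := by
  have key : ∀ (x w : Fin m → Fin 2) (b : Fin 2),
      (insert i X).piecewise (Function.update x i b) w = X.piecewise x (Function.update w i b) := by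
    intro x w b
    ext j
    by_cases hj : j = i
    · subst hj; simp [hi]
    · by_cases hjX : j ∈ X <;> simp [hj, hjX, Finset.piecewise]
  simp only [rr, key]
  rw [Finset.sum_comm]
  have h2 : ∀ f : (Fin m → Fin 2) → ℂ, ∑ w, ∑ b, f (Function.update w i b) = 2 * ∑ w, f w := by
    intro f
    let e := (Equiv.funSplitAt i (Fin 2))
    rw [← e.symm.sum_comp, ← e.symm.sum_comp, Fintype.sum_prod_type, Fintype.sum_prod_type]
    have : ∀ (a b : Fin 2) (g : {j // j ≠ i} → Fin 2),
        Function.update (e.symm (a, g)) i b = e.symm (b, g) := by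
      intro a b g
      ext j
      by_cases hj : j = i
      · subst hj; simp [e]
      · simp [e, hj]
    simp only [this]
    simp only [Fin.sum_univ_two, Finset.sum_add_distrib]
    ring
  exact h2 (fun w => ψ (X.piecewise x w) * (starRingEnd ℂ) (ψ (X.piecewise y w)))

/-- qubit `i` is maximally mixed and decoupled from `X` -/
def Ind (X : Finset (Fin m)) (i : Fin m) : Prop :=
  ∀ x y, rr ψ (insert i X) x y = if x i = y i then rr ψ X x y else 0

lemma Ind_erase {X : Finset (Fin m)} {i j : Fin m} (hj : j ∉ X) (hij : i ≠ j)
    (h : Ind ψ (insert j X) i) : Ind ψ X i := by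
  intro x y
  have h1 := rr_sum ψ (X := insert i X) (i := j) (by simp [hj, hij.symm]) x y
  have h2 := rr_sum ψ hj x y
  rw [Finset.insert_comm] at h1
  simp only [h _ _, Function.update_of_ne hij] at h1
  split_ifs at h1 ⊢ with hx
  · rw [h2] at h1
    exact (mul_left_cancel₀ two_ne_zero h1).symm
  · simpa using h1.symm

lemma Ind_mono {X Y : Finset (Fin m)} {i : Fin m} (hi : i ∉ X) (hY : Y ⊆ X)
    (h : Ind ψ X i) : Ind ψ Y i := by
  induction hk : (X \ Y).card generalizing X with
  | zero =>
    have : X ⊆ Y := by rwa [Finset.card_eq_zero, Finset.sdiff_eq_empty_iff_subset] at hk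
    rwa [Finset.Subset.antisymm hY this]
  | succ k ih =>
    obtain ⟨j, hj⟩ : (X \ Y).Nonempty := by rw [← Finset.card_pos]; omega
    rw [Finset.mem_sdiff] at hj
    have hij : i ≠ j := fun e => hi (e ▸ hj.1)
    refine ih (X := X.erase j) (fun e => hi (Finset.mem_of_mem_erase e)) ?_ ?_ ?_
    · exact fun a ha => Finset.mem_erase.2 ⟨fun e => hj.2 (e ▸ ha), hY ha⟩
    · refine Ind_erase ψ (Finset.notMem_erase j X) hij ?_
      rwa [Finset.insert_erase hj.1]
    · have : X.erase j \ Y = (X \ Y).erase j := by ext a; simp; tauto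
      rw [this, Finset.card_erase_of_mem (by simpa using hj), hk]; rfl

/-- splitting off a qubit -/
def insEquiv {X : Finset (Fin m)} {i : Fin m} (hi : i ∉ X) :
    ({x // x ∈ insert i X} → Fin 2) ≃ ({x // x ∈ X} → Fin 2) × Fin 2 where
  toFun u := (fun j => u ⟨j, Finset.mem_insert_of_mem j.2⟩, u ⟨i, Finset.mem_insert_self i X⟩)
  invFun p := fun j => if h : j.1 ∈ X then p.1 ⟨j.1, h⟩ else p.2
  left_inv u := by
    ext ⟨j, hj⟩
    by_cases h : j ∈ X
    · simp [h]
    · have : j = i := by simpa [h] using hj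
      subst this; simp [h]
  right_inv p := by
    obtain ⟨u, b⟩ := p
    ext
    · simp
    · simp [hi]

/-- extend by zero -/
def ext0 (X : Finset (Fin m)) (u : {x // x ∈ X} → Fin 2) : Fin m → Fin 2 :=
  fun j => if h : j ∈ X then u ⟨j, h⟩ else 0

lemma rd_ext0 (X : Finset (Fin m)) (u v : {x // x ∈ X} → Fin 2) :
    reducedDensity ψ X u v = (2 ^ X.card)⁻¹ * rr ψ X (ext0 X u) (ext0 X v) := by
  rw [rr_eq, inv_mul_cancel_left₀ (by positivity)]
  simp [ext0]

lemma rd_ins {X : Finset (Fin m)} {i : Fin m} (hi : i ∉ X) (u v : {x // x ∈ X} → Fin 2)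
    (a b : Fin 2) :
    reducedDensity ψ (insert i X) ((insEquiv hi).symm (u, a)) ((insEquiv hi).symm (v, b)) =
    (2 ^ (X.card + 1))⁻¹ * rr ψ (insert i X) (Function.update (ext0 X u) i a)
      (Function.update (ext0 X v) i b) := by
  have key : ∀ (u : {x // x ∈ X} → Fin 2) (a : Fin 2),
      (insEquiv hi).symm (u, a) = fun j => Function.update (ext0 X u) i a j.1 := by
    intro u a
    ext ⟨j, hj⟩
    by_cases h : j ∈ X
    · have : j ≠ i := fun e => hi (e ▸ h)
      simp [insEquiv, h, ext0, this]
    · have : j = i := by simpa [h] using hj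
      subst this; simp [insEquiv, h]
  rw [rr_eq, Finset.card_insert_of_notMem hi, inv_mul_cancel_left₀ (by positivity), key, key]

lemma Sent_insert (hn : ∑ x, ‖ψ x‖ ^ 2 = 1) {X : Finset (Fin m)} {i : Fin m} (hi : i ∉ X) :
    Sent ψ (insert i X) ≤ Sent ψ X + Real.log 2 ∧
    (Sent ψ (insert i X) = Sent ψ X + Real.log 2 ↔ Ind ψ X i) := by
  set ρ := (reducedDensity ψ (insert i X)).submatrix (insEquiv hi).symm (insEquiv hi).symm with hρ
  have hpsd : ρ.PosSemidef := (rd_psd ψ _).submatrix _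
  have hptr : ptr ρ = reducedDensity ψ X := by
    ext u v
    simp only [ptr, hρ, Matrix.submatrix_apply, rd_ins]
    rw [← Finset.mul_sum, rr_sum ψ hi, rd_ext0, pow_succ]
    field_simp
  have hS : Sent ψ (insert i X) = vnEntropy ρ := by
    refine vn_congr (rd_psd ψ _).1 hpsd.1 ?_
    rw [show ρ = Matrix.reindex (insEquiv hi) (insEquiv hi) (reducedDensity ψ (insert i X)) from rfl,
      charpoly_reindex, Fintype.card_congr (insEquiv hi)]
  have := vn_ptr hpsd (by rw [hptr]; exact rd_trace ψ hn X) (by rw [hptr]; exact (rd_psd ψ X).1)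
  rw [hptr, ← hS] at this
  refine ⟨this.1, this.2.trans ?_⟩
  constructor
  · intro h x y
    have h1 := congrFun (congrFun h (fun j => x j, x i)) (fun j => y j, y i)
    simp only [hρ, Matrix.submatrix_apply, rd_ins, Matrix.smul_apply, tens] at h1
    have e : ∀ (a b : Fin 2), rr ψ (insert i X) (Function.update (ext0 X fun j => x j) i a)
        (Function.update (ext0 X fun j => y j) i b) = 
        rr ψ (insert i X) (Function.update x i a) (Function.update y i b) := by
      intro a b
      rw [rr_eq, rr_eq]
      have : ∀ (x : Fin m → Fin 2) (a : Fin 2), (fun j : {x // x ∈ insert i X} =>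
        Function.update (ext0 X fun j => x j) i a j) = fun j => Function.update x i a j.1 := by
        intro x a
        ext ⟨j, hj⟩
        by_cases h : j = i
        · subst h; simp
        · have : j ∈ X := by simpa [h] using hj
          simp [h, ext0, this]
      rw [this, this]
    rw [e, Function.update_eq_self, Function.update_eq_self] at h1
    have h2 : (2:ℂ) ^ (X.card + 1) ≠ 0 := by positivity
    rw [inv_mul_eq_iff_eq_mul₀ h2] at h1
    rw [h1]
    split_ifs
    · rw [rr_eq, smul_eq_mul, pow_succ]; ring
    · simp
  · intro h
    ext ⟨u, a⟩ ⟨v, b⟩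
    simp only [hρ, Matrix.submatrix_apply, rd_ins, Matrix.smul_apply, tens, h _ _,
      Function.update_self]
    split_ifs
    · have : ∀ (x : {x // x ∈ X} → Fin 2) (a : Fin 2), (fun j : {x // x ∈ X} =>
        Function.update (ext0 X x) i a j) = x := by
        intro x a
        ext ⟨j, hj⟩
        have : j ≠ i := fun e => hi (e ▸ hj)
        simp [ext0, hj, this]
      rw [rr_eq, this, this, pow_succ, smul_eq_mul]
      field_simp
    · simp

lemma Sent_ind (hn : ∑ x, ‖ψ x‖ ^ 2 = 1) {X Y : Finset (Fin m)} {i : Fin m} (hi : i ∉ X)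
    (hY : Y ⊆ X) (h : Sent ψ (insert i X) = Sent ψ X + Real.log 2) :
    Sent ψ (insert i Y) = Sent ψ Y + Real.log 2 :=
  (Sent_insert ψ hn (fun e => hi (hY e))).2.2
    (Ind_mono ψ hi hY ((Sent_insert ψ hn hi).2.1 h))

end plumbing

section combi

/-- 3-element masks -/
def triples : List ℕ := [7, 11, 13, 14, 19, 21, 22, 25, 26, 28, 35, 37, 38, 41, 42, 44, 49, 50, 52, 56]
/-- 2-element masks -/
def pairs : List ℕ := [3, 5, 6, 9, 10, 12, 17, 18, 20, 24, 33, 34, 36, 40, 48]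
/-- triples above a pair -/
def sup3 (p : ℕ) : List ℕ := triples.filter (fun t => p &&& t == p)
/-- triples disjoint from a pair -/
def sub3 (p : ℕ) : List ℕ := triples.filter (fun t => p &&& t == 0)
/-- pairs below a triple -/
def sub2 (t : ℕ) : List ℕ := pairs.filter (fun p => p &&& t == p)
/-- authorized pair -/
def pa (g : ℕ → Bool) (p : ℕ) : Bool := (sup3 p).all g
/-- minimal triple -/
def mn (g : ℕ → Bool) (t : ℕ) : Bool := g t && (sub2 t).all (fun p => !(pa g p))
/-- forbidden configuration -/
def bad (g : ℕ → Bool) (p : ℕ) : Bool :=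
  (sup3 p).any (mn g) &&
    (sub3 p).any (fun x => mn g x && (sub3 p).any (fun y => mn g y && (x != y)))
/-- all conditions -/
def good (g : ℕ → Bool) : Bool :=
  ([0,1,2,3,4,5].all fun i => triples.any (fun t => !(t.testBit i) && g t)) &&
  ([0,1,2,3,4,5].all fun i => pairs.any (fun p => p.testBit i && pa g p) ||
      triples.any (fun t => t.testBit i && mn g t)) &&
  (pairs.all fun p => !(bad g p))
/-- table -/
def tri (b0 b1 b2 b3 b4 b5 b6 b7 b8 b9 : Bool) (m : ℕ) : Bool :=
  match m with
  | 7 => b0 | 11 => b1 | 13 => b2 | 19 => b3 | 21 => b4 | 25 => b5 | 35 => b6 | 37 => b7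
  | 41 => b8 | 49 => b9
  | 56 => !b0 | 52 => !b1 | 50 => !b2 | 44 => !b3 | 42 => !b4 | 38 => !b5 | 28 => !b6 | 26 => !b7
  | 22 => !b8 | 14 => !b9
  | _ => false

lemma no_good : ∀ b0 b1 b2 b3 b4 b5 b6 b7 b8 b9 : Bool,
    good (tri b0 b1 b2 b3 b4 b5 b6 b7 b8 b9) = false := by
  decide +kernel

/-- set of a mask -/
def ms (m : ℕ) : Finset (Fin 6) := Finset.univ.filter (fun i => m.testBit i.1 = true)

lemma mem_ms (m : ℕ) (i : Fin 6) : i ∈ ms m ↔ m.testBit i.1 = true := by simp [ms]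

lemma ms_sub {p t : ℕ} (h : p &&& t = p) : ms p ⊆ ms t := by
  intro i hi
  rw [mem_ms] at *
  rw [← h, Nat.testBit_and] at hi
  simp at hi; exact hi.2

lemma ms_triple : ∀ T : Finset (Fin 6), T.card = 3 → ∃ t ∈ triples, ms t = T := by decide +kernel
lemma ms_pair : ∀ T : Finset (Fin 6), T.card = 2 → ∃ t ∈ pairs, ms t = T := by decide +kernel
lemma card_triple : ∀ t ∈ triples, (ms t).card = 3 := by decide +kernel
lemma card_pair : ∀ t ∈ pairs, (ms t).card = 2 := by decide +kernel
lemma ms_pt : ∀ p ∈ pairs, ∀ t ∈ triples, ms p ⊆ ms t → p &&& t = p := by decide +kernel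
lemma ms_geo : ∀ p ∈ pairs, ∀ x ∈ sub3 p, ∀ y ∈ sub3 p, x ≠ y →
    (ms p = (ms x ∪ ms y)ᶜ) ∧ ∃ d, d ∈ ms x ∧ d ∉ ms y ∧ ms x ∩ ms y = (ms x).erase d := by
  decide +kernel
lemma ms_compl : ∀ t ∈ triples, ms (63 - t) = (ms t)ᶜ := by decide +kernel

variable {Γ : Finset (Fin 6) → Prop}

lemma exists_min (A : Finset (Fin 6)) (h : Γ A) : ∃ B ⊆ A, IsMinimal Γ B := by
  induction A using Finset.strongInduction with
  | H A ih =>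
    by_cases hm : ∃ B, B ⊂ A ∧ Γ B
    · obtain ⟨B, hB, hG⟩ := hm
      obtain ⟨C, hC, hC'⟩ := ih B hB hG
      exact ⟨C, hC.trans hB.1, hC'⟩
    · push Not at hm
      exact ⟨A, Finset.Subset.refl _, h, hm⟩

lemma exists_triple (hmono : Monotonic Γ) (c1 : ∀ A, IsMinimal Γ A → A.card ≤ 3)
    (Q : Finset (Fin 6)) (hQ : 3 ≤ Q.card) (h : Γ Q) : ∃ T ⊆ Q, T.card = 3 ∧ Γ T := by
  obtain ⟨B, hB, hm⟩ := exists_min Q h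
  obtain ⟨T, hBT, hTQ, hT⟩ := Finset.exists_subsuperset_card_eq hB (c1 B hm) hQ
  exact ⟨T, hTQ, hT, hmono _ _ hm.1 hBT⟩

theorem combi (hmono : Monotonic Γ) (hnc : NoCloning Γ) (hnr : NoRedundancy Γ)
    (c1 : ∀ A, IsMinimal Γ A → A.card ≤ 3)
    (c2 : ∀ A A' B d, IsMinimal Γ A → IsMinimal Γ A' → IsMinimal Γ B → A.card = 3 → A'.card = 3 →
      d ∈ A → d ∉ A' → A ∩ A' = A.erase d → (A ∪ A')ᶜ ⊆ B → False) : False := by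
  classical
  -- singletons
  have hsing : ∀ i, ¬ Γ {i} := by
    intro i hi
    obtain ⟨j, hj⟩ : ∃ j : Fin 6, j ≠ i := exists_ne i
    obtain ⟨A, hA, hjA⟩ := hnr j
    by_cases hiA : i ∈ A
    · refine hA.2 {i} ?_ hi
      rw [Finset.ssubset_iff_of_subset (by simpa using hiA)]
      exact ⟨j, hjA, by simpa using hj⟩
    · refine (hnc {i}).1 hi (hmono _ _ hA.1 ?_)
      intro x hx
      simp only [Finset.mem_compl, Finset.mem_singleton]
      rintro rfl; exact hiA hx
  have hempty : ¬ Γ ∅ := fun h => hsing 0 (hmono _ _ h (Finset.empty_subset _))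
  let g : ℕ → Bool := fun m => decide (Γ (ms m))
  have hg : ∀ m, g m = true ↔ Γ (ms m) := fun m => by simp [g]
  have hgc : ∀ t ∈ triples, g (63 - t) = !(g t) := by
    intro t ht
    have h1 := hnc (ms t)
    simp only [g, ms_compl t ht]
    by_cases h : Γ (ms t)
    · simp [h, h1.1 h]
    · have : Γ (ms t)ᶜ := by by_contra h'; exact h (h1.2 h')
      simp [h, this]
  let f := tri (g 7) (g 11) (g 13) (g 19) (g 21) (g 25) (g 35) (g 37) (g 41) (g 49)
  have hf : ∀ t ∈ triples, f t = g t := by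
    have a0 := hgc 7 (by decide)
    have a1 := hgc 11 (by decide)
    have a2 := hgc 13 (by decide)
    have a3 := hgc 19 (by decide)
    have a4 := hgc 21 (by decide)
    have a5 := hgc 25 (by decide)
    have a6 := hgc 35 (by decide)
    have a7 := hgc 37 (by decide)
    have a8 := hgc 41 (by decide)
    have a9 := hgc 49 (by decide)
    norm_num at a0 a1 a2 a3 a4 a5 a6 a7 a8 a9
    intro t ht
    simp only [triples, List.mem_cons, List.not_mem_nil, or_false] at ht
    rcases ht with rfl | rfl | rfl | rfl | rfl | rfl | rfl | rfl | rfl | rfl | rfl | rfl | rfl |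
      rfl | rfl | rfl | rfl | rfl | rfl | rfl <;>
      simp only [f, tri, a0, a1, a2, a3, a4, a5, a6, a7, a8, a9]
  have hft : ∀ t ∈ triples, (f t = true ↔ Γ (ms t)) := fun t ht => by rw [hf t ht, hg]
  have hsup : ∀ p t, t ∈ sup3 p ↔ t ∈ triples ∧ p &&& t = p := by
    intro p t; simp [sup3]
  have hpa : ∀ p ∈ pairs, (pa f p = true ↔ Γ (ms p)) := by
    intro p hp
    simp only [pa, List.all_eq_true]
    constructor
    · intro h
      by_contra hn
      have hc : Γ (ms p)ᶜ := by by_contra h'; exact hn ((hnc _).2 h')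
      obtain ⟨T, hT, hT3, hΓ⟩ := exists_triple hmono c1 _
        (by rw [Finset.card_compl, card_pair p hp]; decide) hc
      obtain ⟨t, ht, htT⟩ := ms_triple Tᶜ (by rw [Finset.card_compl, hT3]; decide)
      have hsub : ms p ⊆ ms t := by
        rw [htT]; exact Finset.subset_compl_comm.1 hT
      have := (hft t ht).1 (h t ((hsup p t).2 ⟨ht, ms_pt p hp t ht hsub⟩))
      rw [htT] at this
      exact (hnc T).1 hΓ this
    · intro h t ht
      rw [hsup] at ht
      exact (hft t ht.1).2 (hmono _ _ h (ms_sub ht.2))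
  have hmn : ∀ t ∈ triples, (mn f t = true ↔ IsMinimal Γ (ms t)) := by
    intro t ht
    simp only [mn, Bool.and_eq_true, List.all_eq_true, hft t ht, Bool.not_eq_true']
    have hs2 : ∀ p, p ∈ sub2 t ↔ p ∈ pairs ∧ p &&& t = p := by intro p; simp [sub2]
    constructor
    · rintro ⟨h1, h2⟩
      refine ⟨h1, fun B hB hΓ => ?_⟩
      have hc := Finset.card_lt_card hB
      rw [card_triple t ht] at hc
      obtain ⟨P, hBP, hPt, hP⟩ := Finset.exists_subsuperset_card_eq hB.1
        (show B.card ≤ 2 by omega) (by rw [card_triple t ht]; omega)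
      obtain ⟨p, hp, rfl⟩ := ms_pair P hP
      have := h2 p ((hs2 p).2 ⟨hp, ms_pt p hp t ht hPt⟩)
      rw [(hpa p hp).2 (hmono _ _ hΓ hBP)] at this
      exact absurd this (by decide)
    · rintro ⟨h1, h2⟩
      refine ⟨h1, fun p hp => ?_⟩
      rw [hs2] at hp
      by_contra hh
      rw [Bool.not_eq_false, hpa p hp.1] at hh
      refine h2 _ ?_ hh
      refine Finset.ssubset_iff_subset_ne.2 ⟨ms_sub hp.2, fun e => ?_⟩
      have := congrArg Finset.card e
      rw [card_triple t ht, card_pair p hp.1] at this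
      omega
  have hgood : good f = true := by
    have hlt : ∀ i ∈ [0,1,2,3,4,5], i < 6 := by decide
    simp only [good, Bool.and_eq_true, List.all_eq_true, List.any_eq_true, Bool.or_eq_true,
      Bool.not_eq_true']
    refine ⟨⟨fun i hi => ?_, fun i hi => ?_⟩, fun p hp => ?_⟩
    · have hc : Γ ({⟨i, hlt i hi⟩} : Finset (Fin 6))ᶜ := by
        by_contra h'; exact hsing _ ((hnc _).2 h')
      obtain ⟨T, hT, hT3, hΓ⟩ := exists_triple hmono c1 _
        (by rw [Finset.card_compl, Finset.card_singleton]; decide) hc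
      obtain ⟨t, ht, rfl⟩ := ms_triple T hT3
      refine ⟨t, ht, ?_, (hft t ht).2 hΓ⟩
      by_contra hb
      rw [Bool.not_eq_false] at hb
      have := hT ((mem_ms t ⟨i, hlt i hi⟩).2 hb)
      simp at this
    · obtain ⟨A, hA, hiA⟩ := hnr ⟨i, hlt i hi⟩
      have h3 := c1 A hA
      have h0 : A.card ≠ 0 := fun h => by
        rw [Finset.card_eq_zero] at h; exact hempty (h ▸ hA.1)
      have h1 : A.card ≠ 1 := fun h => by
        obtain ⟨a, ha⟩ := Finset.card_eq_one.1 h; exact hsing a (ha ▸ hA.1)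
      rcases (show A.card = 2 ∨ A.card = 3 by omega) with h | h
      · left
        obtain ⟨p, hp, rfl⟩ := ms_pair A h
        exact ⟨p, hp, (mem_ms p ⟨i, _⟩).1 hiA, (hpa p hp).2 hA.1⟩
      · right
        obtain ⟨p, hp, rfl⟩ := ms_triple A h
        exact ⟨p, hp, (mem_ms p ⟨i, _⟩).1 hiA, (hmn p hp).2 hA⟩
    · by_contra hb
      rw [Bool.not_eq_false] at hb
      simp only [bad, Bool.and_eq_true, List.any_eq_true] at hb
      obtain ⟨⟨t, ht, htm⟩, x, hx, hxm, y, hy, hym, hxy⟩ := hb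
      obtain ⟨e1, d, hd1, hd2, hd3⟩ := ms_geo p hp x hx y hy (by simpa using hxy)
      have hxt : x ∈ triples := List.mem_of_mem_filter hx
      have hyt : y ∈ triples := List.mem_of_mem_filter hy
      rw [hsup] at ht
      exact c2 _ _ _ d ((hmn x hxt).1 hxm) ((hmn y hyt).1 hym) ((hmn t ht.1).1 htm)
        (card_triple x hxt) (card_triple y hyt) hd1 hd2 hd3 (e1 ▸ ms_sub ht.2)
  rw [no_good] at hgood
  exact absurd hgood (by decide)

end combi

section entropic
variable {Γ : Finset (Fin 6) → Prop} {s : Finset (Fin 6) → ℝ} {L : ℝ}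

lemma s_min (h0 : s ∅ = 0) (hR : ∀ A, Γ A → s Aᶜ = s A - L) (hN : ∀ A, ¬ Γ A → s Aᶜ = s A + L)
    (h1 : ∀ A i, i ∉ A → s (insert i A) ≤ s A + L)
    (h2 : ∀ X Y i, i ∉ X → Y ⊆ X → s (insert i X) = s X + L → s (insert i Y) = s Y + L)
    {A : Finset (Fin 6)} (hA : IsMinimal Γ A) (Y : Finset (Fin 6)) (hY : Y ⊆ A) :
    s Y = Y.card * L := by
  induction Y using Finset.induction_on with
  | empty => simp [h0]
  | insert i Y hi ih =>
    have hiA : i ∈ A := hY (Finset.mem_insert_self _ _)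
    have hYA : Y ⊆ A.erase i := fun x hx =>
      Finset.mem_erase.2 ⟨fun e => hi (e ▸ hx), hY (Finset.mem_insert_of_mem hx)⟩
    have e1 := hN _ (hA.2 _ (Finset.erase_ssubset hiA))
    rw [Finset.compl_erase] at e1
    have e2 := h1 Aᶜ i (by simpa using hiA)
    have e3 := hR A hA.1
    have e4 := h1 (A.erase i) i (Finset.notMem_erase i A)
    have e5 : s (insert i (A.erase i)) = s (A.erase i) + L := by
      rw [Finset.insert_erase hiA] at e4 ⊢; linarith
    rw [h2 _ _ _ (Finset.notMem_erase i A) hYA e5,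
      ih (fun x hx => hY (Finset.mem_insert_of_mem hx)), Finset.card_insert_of_notMem hi]
    push_cast; ring

lemma s_card (h0 : s ∅ = 0) (h1 : ∀ A i, i ∉ A → s (insert i A) ≤ s A + L) (Y : Finset (Fin 6)) :
    s Y ≤ Y.card * L := by
  induction Y using Finset.induction_on with
  | empty => simp [h0]
  | insert i Y hi ih =>
    have := h1 Y i hi
    rw [Finset.card_insert_of_notMem hi]
    push_cast; linarith

theorem entropic (hL : 0 < L) (hmono : Monotonic Γ) (hnc : NoCloning Γ) (hnr : NoRedundancy Γ)
    (h0 : s ∅ = 0) (hR : ∀ A, Γ A → s Aᶜ = s A - L) (hN : ∀ A, ¬ Γ A → s Aᶜ = s A + L)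
    (h1 : ∀ A i, i ∉ A → s (insert i A) ≤ s A + L)
    (h2 : ∀ X Y i, i ∉ X → Y ⊆ X → s (insert i X) = s X + L → s (insert i Y) = s Y + L) :
    False := by
  have hm : ∀ {A}, IsMinimal Γ A → ∀ Y ⊆ A, s Y = Y.card * L :=
    fun hA => s_min h0 hR hN h1 h2 hA
  refine combi hmono hnc hnr ?_ ?_
  · intro A hA
    have e1 := hm hA A (Finset.Subset.refl _)
    have e2 := hR A hA.1
    have e3 := s_card h0 h1 Aᶜ
    have e4 : A.card + Aᶜ.card = 6 := by simpa using Finset.card_add_card_compl A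
    have e5 : (A.card : ℝ) + (Aᶜ.card : ℝ) = 6 := by exact_mod_cast e4
    by_contra h
    have h4 : (4:ℝ) ≤ A.card := by exact_mod_cast (show 4 ≤ A.card by omega)
    have : (Aᶜ.card : ℝ) = 6 - A.card := by linarith
    rw [this] at e3
    nlinarith
  · intro A A' B d hA hA' hB hc hc' hdA hdA' hI hYB
    have e1 := hR A hA.1
    rw [hm hA A (Finset.Subset.refl _), hc] at e1
    have e2 := hR A' hA'.1
    rw [hm hA' A' (Finset.Subset.refl _), hc'] at e2
    have e3 := hN _ (hA.2 _ (Finset.erase_ssubset hdA))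
    rw [hm hA _ (Finset.erase_subset _ _), Finset.card_erase_of_mem hdA, hc,
      Finset.compl_erase] at e3
    have hYsub : (A ∪ A')ᶜ ⊆ Aᶜ := Finset.compl_subset_compl.2 Finset.subset_union_left
    have e4 := h2 Aᶜ _ d (by simpa using hdA) hYsub (by rw [e3, e1]; push_cast; ring)
    have hins : insert d (A ∪ A')ᶜ = A'ᶜ := by
      ext x
      have := congrArg (x ∈ ·) hI
      simp only [Finset.mem_inter, Finset.mem_erase, eq_iff_iff] at this
      simp only [Finset.mem_insert, Finset.mem_compl, Finset.mem_union]
      by_cases hx : x = d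
      · subst hx; simp [hdA']
      · tauto
    have hdY : d ∉ (A ∪ A')ᶜ := by simp [hdA]
    have hcY : (A ∪ A')ᶜ.card = 2 := by
      have := congrArg Finset.card hins
      rw [Finset.card_insert_of_notMem hdY, Finset.card_compl A', hc', Fintype.card_fin] at this
      omega
    rw [hins, e2, hm hB _ hYB, hcY] at e4
    push_cast at e4
    linarith

end entropic

lemma posOf_compl {n : ℕ} (A : Finset (Fin n)) : insert 0 (posOf A) = (posOf Aᶜ)ᶜ := by
  ext x
  refine Fin.cases ?_ (fun i => ?_) x
  · simp [posOf]
  · simp [posOf, Fin.succ_ne_zero]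

theorem stmt13 :
    ¬ ∃ (Γ : Finset (Fin 6) → Prop) (ψ : (Fin (6 + 1) → Fin 2) → ℂ),
      Monotonic Γ ∧ NoCloning Γ ∧ NoRedundancy Γ ∧ IsPureQSSState Γ ψ := by
  rintro ⟨Γ, ψ, hmono, hnc, hnr, hq⟩
  have hn := hq.normalized
  have ht : ∀ A, Sent ψ (insert 0 (posOf A)) = Sent ψ (posOf Aᶜ) := fun A => by
    rw [posOf_compl, Sent_compl]
  have hs0 : Sent ψ (posOf (∅ : Finset (Fin 6))) = 0 := by
    simpa [posOf] using Sent_empty ψ hn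
  have hu : Γ Finset.univ := by
    obtain ⟨A, hA, _⟩ := hnr 0
    exact hmono _ _ hA.1 (Finset.subset_univ _)
  have hS : Sent ψ {0} = Real.log 2 := by
    have e1 := hq.recover _ hu
    rw [ht, Finset.compl_univ, hs0] at e1
    have e2 := ht ∅
    rw [Finset.compl_empty] at e2
    have e3 : insert 0 (posOf (∅ : Finset (Fin 6))) = {0} := by simp [posOf]
    rw [e3] at e2
    linarith
  have hns : ∀ (A : Finset (Fin 6)) (i : Fin 6), i ∉ A → i.succ ∉ posOf A := by
    intro A i hi; simpa [posOf] using hi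
  have hins : ∀ (A : Finset (Fin 6)) (i : Fin 6), posOf (insert i A) = insert i.succ (posOf A) := by
    intro A i; simp [posOf, Finset.image_insert]
  refine entropic (Γ := Γ) (s := fun A => Sent ψ (posOf A)) (L := Real.log 2)
    (Real.log_pos (by norm_num)) hmono hnc hnr hs0 ?_ ?_ ?_ ?_
  · intro A hA
    have := hq.recover A hA
    rw [ht, hS] at this
    linarith
  · intro A hA
    have := hq.secrecy A hA
    rw [ht, hS] at this
    linarith
  · intro A i hi
    simp only [hins]
    exact (Sent_insert ψ hn (hns A i hi)).1
  · intro X Y i hi hY h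
    simp only [hins] at h ⊢
    exact Sent_ind ψ hn (hns X i hi) (Finset.image_subset_image hY) h
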